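/- arXiv:1809.02628 — 6 statements merged into one kernel-verified Lean document; each statement's English description precedes it below -/
import Mathlib

section
/- Let X be a compact, connected, locally connected metric space which is locally 1-connected. Then for every basepoint x ∈ X, the fundamental group π₁(X, x) is finitely generated. -/
open unitInterval

open Topology in
/-- Two points of a preconnected set are joined by a chain of points of the set with steps shorter
than `δ`, written as a sequence which is eventually constant. -/
theorem IsPreconnected.exists_chain {X : Type*} [PseudoMetricSpace X] {s : Set X}
    (hs : IsPreconnected s) {δ : ℝ} (hδ : 0 < δ) {x y : X} (hx : x ∈ s) (hy : y ∈ s) :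
    ∃ (k : ℕ) (Q : ℕ → X), Q 0 = x ∧ (∀ j, k ≤ j → Q j = y) ∧
      ∀ j, Q j ∈ s ∧ dist (Q j) (Q (j + 1)) < δ := by
  have key : Relation.ReflTransGen (fun a b ↦ b ∈ s ∧ dist a b < δ) x y := by
    refine hs.induction₂' _ (fun a ha ↦ ?_) (fun a b c _ _ _ ↦ Relation.ReflTransGen.trans) hx hy
    filter_upwards [self_mem_nhdsWithin, mem_nhdsWithin_of_mem_nhds (Metric.ball_mem_nhds a hδ)]
      with b hb hab
    exact ⟨.single ⟨hb, by rwa [dist_comm]⟩, .single ⟨ha, hab⟩⟩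
  clear hy
  induction key with
  | refl => exact ⟨0, fun _ ↦ x, rfl, fun _ _ ↦ rfl, fun _ ↦ ⟨hx, by simpa⟩⟩
  | @tail b c _ hbc ih =>
    obtain ⟨k, Q, h0, hk, hQ⟩ := ih
    refine ⟨k + 1, fun j ↦ if j ≤ k then Q j else c, by simpa, fun j hj ↦ if_neg (by omega),
      fun j ↦ ⟨?_, ?_⟩⟩
    · dsimp only
      split_ifs
      exacts [(hQ j).1, hbc.1]
    · rcases lt_trichotomy j k with h | rfl | h
      · simpa [h.le, Nat.succ_le_of_lt h] using (hQ j).2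
      · simpa [hk j le_rfl] using hbc.2
      · simpa [h.not_ge, (Nat.lt_succ_of_lt h).not_ge] using hδ

/-- A chain whose consecutive points lie in small preconnected sets can be refined to a chain with
arbitrarily short steps, all steps being subdivided into the same number of pieces. -/
theorem exists_chain_refinement {X : Type*} [PseudoMetricSpace X] {δ δ' c : ℝ} (hδ' : 0 < δ')
    (hδ : ∀ u v : X, dist u v < δ → ∃ s : Set X, IsPreconnected s ∧ u ∈ s ∧ v ∈ s ∧
      s ⊆ Metric.ball u c)
    {y : X} {M : ℕ} {P : ℕ → X} (hP : ∀ i, dist (P i) (P (i + 1)) < δ)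
    (hy : ∀ i, M ≤ i → P i = y) :
    ∃ (k : ℕ) (P' : ℕ → X), 0 < k ∧ P' 0 = P 0 ∧ (∀ i, k * M ≤ i → P' i = y) ∧
      (∀ i, dist (P' i) (P' (i + 1)) < δ') ∧ ∀ i, dist (P (i / k)) (P' i) < c := by
  have hchain : ∀ i, ∃ (k : ℕ) (Q : ℕ → X), Q 0 = P i ∧ (∀ j, k ≤ j → Q j = P (i + 1)) ∧
      (∀ j, dist (P i) (Q j) < c ∧ dist (Q j) (Q (j + 1)) < δ') ∧ (M ≤ i → k = 0) := by
    intro i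
    obtain ⟨s, hs, hi, hi', hsc⟩ := hδ _ _ (hP i)
    by_cases hM : M ≤ i
    · refine ⟨0, fun _ ↦ P i, rfl, fun j _ ↦ ?_, fun j ↦ ⟨?_, by simpa⟩, fun _ ↦ rfl⟩
      · rw [hy i hM, hy (i + 1) (by omega)]
      · simpa [dist_comm] using hsc hi
    · obtain ⟨k, Q, h0, hk, hQ⟩ := hs.exists_chain hδ' hi hi'
      refine ⟨k, Q, h0, hk, fun j ↦ ⟨?_, (hQ j).2⟩, fun h ↦ absurd h hM⟩
      simpa [dist_comm] using hsc (hQ j).1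
  choose kk Q h0 hk hQ hM using hchain
  set k := (Finset.range M).sup kk + 1 with hkdef
  have hkk : ∀ i, kk i ≤ k := by
    intro i
    by_cases h : M ≤ i
    · simp [hM i h]
    · exact (Finset.le_sup (f := kk) (Finset.mem_range.2 (not_le.1 h))).trans (Nat.le_succ _)
  have hk0 : 0 < k := Nat.succ_pos _
  clear_value k
  refine ⟨k, fun j ↦ Q (j / k) (j % k), hk0, by simp [h0], fun i hi ↦ ?_, fun i ↦ ?_,
    fun i ↦ (hQ _ _).1⟩
  · have hMi : M ≤ i / k := (Nat.le_div_iff_mul_le hk0).2 (by rwa [mul_comm])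
    dsimp only
    rw [hk _ _ (by simp [hM _ hMi]), hy _ (by omega)]
  · dsimp only
    by_cases h : i % k + 1 = k
    · have h1 : (i + 1) / k = i / k + 1 := by
        rw [Nat.succ_div, if_pos ((Nat.dvd_iff_mod_eq_zero).2 (by
          rw [Nat.add_mod]; by_cases hk1 : k = 1
          · subst hk1; simp [Nat.mod_one]
          · rw [Nat.mod_eq_of_lt (a := 1) (by omega), h, Nat.mod_self]))]
      have h2 : (i + 1) % k = 0 := by
        have e1 := Nat.div_add_mod i k
        have e2 := Nat.div_add_mod (i + 1) k
        rw [h1, mul_add] at e2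
        omega
      have := (hQ (i / k) (i % k)).2
      rw [h, hk _ _ (hkk _)] at this
      rwa [h1, h2, h0]
    · have hlt : i % k + 1 < k := by have := Nat.mod_lt i hk0; omega
      have h1 : (i + 1) / k = i / k ∧ (i + 1) % k = i % k + 1 := by
        rw [Nat.div_mod_unique hk0]
        exact ⟨by have := Nat.div_add_mod i k; omega, hlt⟩
      rw [h1.1, h1.2]
      exact (hQ _ _).2

/-- In a compact locally connected metric space, nearby points lie in a common small preconnected
set. -/
theorem exists_preconnected_of_dist_lt (X : Type*) [PseudoMetricSpace X] [CompactSpace X]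
    [LocallyConnectedSpace X] {ε : ℝ} (hε : 0 < ε) :
    ∃ δ > 0, ∀ u v : X, dist u v < δ → ∃ s : Set X, IsPreconnected s ∧ u ∈ s ∧ v ∈ s ∧
      s ⊆ Metric.ball u ε := by
  obtain ⟨δ, hδ, h⟩ := lebesgue_number_lemma_of_metric (s := (Set.univ : Set X)) isCompact_univ
    (c := fun x ↦ connectedComponentIn (Metric.ball x (ε / 2)) x)
    (fun x ↦ Metric.isOpen_ball.connectedComponentIn)
    (fun x _ ↦ Set.mem_iUnion.2 ⟨x, mem_connectedComponentIn (Metric.mem_ball_self (by linarith))⟩)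
  refine ⟨δ, hδ, fun u v huv ↦ ?_⟩
  obtain ⟨x, hx⟩ := h u trivial
  have hu := hx (Metric.mem_ball_self hδ)
  refine ⟨_, isPreconnected_connectedComponentIn, hu, hx (by rwa [Metric.mem_ball, dist_comm]),
    (connectedComponentIn_subset _ _).trans (Metric.ball_subset_ball' ?_)⟩
  have := connectedComponentIn_subset _ _ hu
  rw [Metric.mem_ball, dist_comm] at this
  linarith

open Filter Topology in
/-- In a compact locally connected metric space, nearby points are joined by small paths. -/
theorem exists_path_of_dist_lt (X : Type*) [MetricSpace X] [CompactSpace X]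
    [LocallyConnectedSpace X] {ε : ℝ} (hε : 0 < ε) :
    ∃ δ > 0, ∀ u v : X, dist u v < δ → ∃ p : Path u v, Set.range p ⊆ Metric.ball u ε := by
  have hc : ∀ n : ℕ, 0 < ε / 3 / 2 / 2 ^ n := fun n ↦ by positivity
  choose δ hδ hconn using fun n ↦ exists_preconnected_of_dist_lt X (hc n)
  refine ⟨δ 0, hδ 0, fun x y hxy ↦ ?_⟩
  let Good : ℕ → ℕ × (ℕ → X) → Prop := fun n s ↦ 0 < s.1 ∧ s.2 0 = x ∧
    (∀ i, s.1 ≤ i → s.2 i = y) ∧ ∀ i, dist (s.2 i) (s.2 (i + 1)) < δ n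
  have step : ∀ n s, Good n s → ∃ s', Good (n + 1) s' ∧ ∃ k : ℕ, 0 < k ∧ s'.1 = k * s.1 ∧
      ∀ i, dist (s.2 (i / k)) (s'.2 i) < ε / 3 / 2 / 2 ^ n := by
    rintro n ⟨M, P⟩ ⟨hM, h0, hy, hP⟩
    obtain ⟨k, P', hk, h0', hy', hP', hPP'⟩ :=
      exists_chain_refinement (hδ (n + 1)) (hconn n) hP hy
    exact ⟨(k * M, P'), ⟨Nat.mul_pos hk hM, h0'.trans h0, hy', hP'⟩, k, hk, rfl, hPP'⟩
  choose! next hnext hrel using step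
  let s : ℕ → ℕ × (ℕ → X) :=
    fun n ↦ Nat.rec (1, fun i ↦ if i = 0 then x else y) (fun n s ↦ next n s) n
  have hgood : ∀ n, Good n (s n) := by
    intro n
    induction n with
    | zero =>
      refine ⟨one_pos, rfl, fun i hi ↦ if_neg (by change 1 ≤ i at hi; omega), fun i ↦ ?_⟩
      rcases i with _ | i
      · simpa [s] using hxy
      · simpa [s] using hδ 0
    | succ n ih => exact hnext n _ ih
  let f : ℕ → unitInterval → X := fun n t ↦ (s n).2 ⌊(t : ℝ) * (s n).1⌋₊
  have hstep : ∀ t n, dist (f n t) (f (n + 1) t) ≤ ε / 3 / 2 / 2 ^ n := by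
    intro t n
    obtain ⟨k, hk, hM, h⟩ := hrel n _ (hgood n)
    have := h ⌊(t : ℝ) * (s (n + 1)).1⌋₊
    have e : ⌊(t : ℝ) * (s (n + 1)).1⌋₊ / k = ⌊(t : ℝ) * (s n).1⌋₊ := by
      rw [← Nat.floor_div_natCast]
      change ⌊(t : ℝ) * ((next n (s n)).1 : ℕ) / k⌋₊ = _
      rw [hM]
      congr 1
      push_cast
      field_simp
    rw [e] at this
    exact this.le
  choose g hg using fun t ↦ cauchySeq_tendsto_of_complete (cauchySeq_of_le_geometric_two (hstep t))
  have hfg : ∀ n t, dist (f n t) (g t) ≤ ε / 3 / 2 ^ n := fun n t ↦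
    dist_le_of_le_geometric_two_of_tendsto (hstep t) (hg t) n
  have hosc : ∀ n i, dist ((s n).2 i) ((s n).2 (i + 1)) < ε / 3 / 2 / 2 ^ n := by
    intro n i
    obtain ⟨C, -, -, h, hC⟩ := hconn n _ _ ((hgood n).2.2.2 i)
    simpa [dist_comm] using hC h
  have hcont : Continuous g := by
    rw [Metric.continuous_iff]
    intro t η hη
    obtain ⟨n, hn⟩ : ∃ n : ℕ, ε / 3 / 2 ^ n < η / 3 := by
      obtain ⟨n, hn⟩ := exists_pow_lt_of_lt_one (show 0 < η / ε by positivity)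
        (show (1 / 2 : ℝ) < 1 by norm_num)
      refine ⟨n, ?_⟩
      rw [lt_div_iff₀ hε] at hn
      rw [one_div, inv_pow] at hn
      rw [div_eq_mul_inv]
      linarith
    have hM : (0 : ℝ) < (s n).1 := Nat.cast_pos.2 (hgood n).1
    refine ⟨1 / (s n).1, by positivity, fun t' ht' ↦ ?_⟩
    have hff : dist (f n t') (f n t) < η / 3 := by
      rw [Subtype.dist_eq, Real.dist_eq, lt_div_iff₀ hM] at ht'
      nth_rewrite 1 [← abs_of_pos hM] at ht'
      rw [← abs_mul, sub_mul, abs_lt] at ht'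
      have ha := Nat.floor_le (mul_nonneg t.2.1 hM.le)
      have hb := Nat.lt_floor_add_one ((t : ℝ) * (s n).1)
      have ha' := Nat.floor_le (mul_nonneg t'.2.1 hM.le)
      have hb' := Nat.lt_floor_add_one ((t' : ℝ) * (s n).1)
      have h1 : ⌊(t : ℝ) * (s n).1⌋₊ < ⌊(t' : ℝ) * (s n).1⌋₊ + 2 := by
        rw [← Nat.cast_lt (α := ℝ)]; push_cast; linarith
      have h2 : ⌊(t' : ℝ) * (s n).1⌋₊ < ⌊(t : ℝ) * (s n).1⌋₊ + 2 := by
        rw [← Nat.cast_lt (α := ℝ)]; push_cast; linarith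
      have hsm : ε / 3 / 2 / 2 ^ n < η / 3 := by
        have : ε / 3 / 2 / 2 ^ n = ε / 3 / 2 ^ n / 2 := by ring
        have : 0 < ε / 3 / 2 ^ n := by positivity
        linarith
      have h3 : ⌊(t' : ℝ) * (s n).1⌋₊ = ⌊(t : ℝ) * (s n).1⌋₊ ∨
          ⌊(t' : ℝ) * (s n).1⌋₊ = ⌊(t : ℝ) * (s n).1⌋₊ + 1 ∨
          ⌊(t : ℝ) * (s n).1⌋₊ = ⌊(t' : ℝ) * (s n).1⌋₊ + 1 := by omega
      dsimp only [f]
      rcases h3 with h | h | h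
      · rw [h, dist_self]; positivity
      · rw [h, dist_comm]; exact (hosc n _).trans hsm
      · rw [h]; exact (hosc n _).trans hsm
    have h1 := hfg n t
    have h2 := hfg n t'
    rw [dist_comm] at h2
    calc dist (g t') (g t) ≤ dist (g t') (f n t') + dist (f n t') (f n t) + dist (f n t) (g t) :=
          dist_triangle4 _ _ _ _
      _ < η := by linarith
  have hg0 : g 0 = x := tendsto_nhds_unique (hg 0) <| tendsto_const_nhds.congr fun n ↦ by
    simpa [f] using (hgood n).2.1.symm
  have hg1 : g 1 = y := tendsto_nhds_unique (hg 1) <| tendsto_const_nhds.congr fun n ↦ by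
    simpa [f] using ((hgood n).2.2.1 _ le_rfl).symm
  refine ⟨⟨⟨g, hcont⟩, hg0, hg1⟩, ?_⟩
  rintro _ ⟨t, rfl⟩
  change dist (g t) x < ε
  have h0 : dist (f 0 t) x < ε / 3 := by
    have h0 := (hgood 0).2.1
    have h1 := hosc 0 0
    rw [h0, (hgood 0).2.2.1 (0 + 1) le_rfl, dist_comm] at h1
    dsimp only [f]
    rcases Nat.eq_zero_or_pos ⌊(t : ℝ) * (s 0).1⌋₊ with h | h
    · rw [h, h0, dist_self]
      positivity
    · rw [(hgood 0).2.2.1 _ h]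
      norm_num at h1
      linarith
  have h1 := hfg 0 t
  rw [dist_comm] at h1
  have := dist_triangle (g t) (f 0 t) x
  simp at h1
  linarith

open CategoryTheory in
/-- If paths with the same endpoints are homotopic as soon as they stay in a common `ε`-ball,
and nearby points are joined by paths staying in an `ε / 4`-ball, then the fundamental group of a
compact path connected space is finitely generated. -/
theorem FundamentalGroup.fg_of_uniform {X : Type*} [PseudoMetricSpace X] [CompactSpace X]
    [PathConnectedSpace X] {ε δ : ℝ} (hε : 0 < ε) (hδ : 0 < δ)
    (hhom : ∀ (c u v : X) (p q : Path u v), Set.range p ⊆ Metric.ball c ε →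
      Set.range q ⊆ Metric.ball c ε → p.Homotopic q)
    (hpath : ∀ u v : X, dist u v < δ → ∃ p : Path u v, Set.range p ⊆ Metric.ball u (ε / 4))
    (x : X) : Group.FG (FundamentalGroup X x) := by
  obtain ⟨T, -, hT, hcov⟩ := totallyBounded_iff_subset.1
    (isCompact_univ (X := X)).totallyBounded _ (Metric.dist_mem_uniformity hδ)
  have hnear : ∀ u : X, ∃ a ∈ T, dist u a < δ := fun u ↦ by
    simpa using hcov (Set.mem_univ u)
  choose a haT ha using hnear
  choose ν hν using fun u ↦ hpath u (a u) (ha u)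
  let cls : ∀ {u v : X}, Path u v → (FundamentalGroupoid.mk u ⟶ FundamentalGroupoid.mk v) :=
    fun p ↦ Path.Homotopic.Quotient.mk p
  have cls_trans : ∀ {u v w : X} (p : Path u v) (q : Path v w),
      cls (p.trans q) = cls p ≫ cls q := fun p q ↦ Path.Homotopic.Quotient.mk_trans p q
  have cls_symm : ∀ {u v : X} (p : Path u v), cls p.symm = inv (cls p) := fun p ↦ by
    rw [← Groupoid.inv_eq_inv]; exact Path.Homotopic.Quotient.mk_symm p
  let ρ : ∀ u : X, Path x u := fun u ↦ PathConnectedSpace.somePath x u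
  let τ : ∀ u : X, Path x u := fun u ↦ (ρ (a u)).trans (ν u).symm
  let Φ : ∀ {u v : X}, Path u v → FundamentalGroup X x :=
    fun {u v} p ↦ cls (τ u) ≫ cls p ≫ inv (cls (τ v))
  have Φ_trans : ∀ {u v w : X} (p : Path u v) (q : Path v w), Φ (p.trans q) = Φ q * Φ p := by
    intro u v w p q
    simp only [Φ, End.mul_def, cls_trans, Category.assoc, IsIso.inv_hom_id_assoc]
  have Φ_congr : ∀ {u v : X} {p q : Path u v}, p.Homotopic q → Φ p = Φ q := by
    intro u v p q h
    have : cls p = cls q := Path.Homotopic.Quotient.eq.2 h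
    simp only [Φ, this]
  let S : X → X → Set (FundamentalGroup X x) := fun b c ↦
    {g | ∃ q : Path b c, Set.range q ⊆ Metric.ball b ε ∧
      g = (cls (ρ b) ≫ cls q ≫ inv (cls (ρ c)) :)}
  have hS : ∀ b c, (S b c).Subsingleton := by
    rintro b c _ ⟨q, hq, rfl⟩ _ ⟨q', hq', rfl⟩
    have : cls q = cls q' := Path.Homotopic.Quotient.eq.2 (hhom b b c q q' hq hq')
    rw [this]
  let S' : Set (FundamentalGroup X x) := ⋃ b ∈ T, ⋃ c ∈ T, S b c
  have hfin : S'.Finite := hT.biUnion fun b _ ↦ hT.biUnion fun c _ ↦ (hS b c).finite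
  have hsmall : ∀ {u v : X} (p : Path u v), Set.range p ⊆ Metric.ball u (ε / 4) →
      Φ p ∈ Subgroup.closure S' := by
    intro u v p hp
    refine Subgroup.subset_closure ?_
    simp only [S', Set.mem_iUnion]
    refine ⟨a u, haT u, a v, haT v, (ν u).symm.trans (p.trans (ν v)), ?_, ?_⟩
    · have hau : dist u (a u) < ε / 4 := by
        simpa [dist_comm] using hν u (ν u).target_mem_range
      have huv : dist v u < ε / 4 := by simpa using hp p.target_mem_range
      rw [Path.trans_range, Path.trans_range, Path.symm_range]
      refine Set.union_subset ((hν u).trans (Metric.ball_subset_ball' (by linarith)))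
        (Set.union_subset (hp.trans (Metric.ball_subset_ball' (by linarith)))
          ((hν v).trans (Metric.ball_subset_ball' ?_)))
      have := dist_triangle v u (a u)
      linarith
    · simp [Φ, τ, cls_trans, cls_symm]
  have hall : ∀ {u v : X} (p : Path u v), Φ p ∈ Subgroup.closure S' := by
    intro u v p
    have key : Φ (p.subpath 0 1) ∈ Subgroup.closure S' := by
      refine PreconnectedSpace.induction₂' (fun s t ↦ Φ (p.subpath s t) ∈ Subgroup.closure S')
        (fun s ↦ ?_) ⟨fun r s t hrs hst ↦ ?_⟩ 0 1
      · obtain ⟨η, hη, hball⟩ := Metric.mem_nhds_iff.1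
          (p.continuous.continuousAt.preimage_mem_nhds
            (Metric.ball_mem_nhds (p s) (show 0 < ε / 8 by positivity)))
        filter_upwards [Metric.ball_mem_nhds s hη] with t ht
        have hsub : p '' Set.uIcc s t ⊆ Metric.ball (p s) (ε / 8) := by
          rintro _ ⟨r, hr, rfl⟩
          have hrs : dist s r ≤ dist s t := Real.dist_left_le_of_mem_uIcc hr
          rw [dist_comm s r, dist_comm s t] at hrs
          exact hball (Metric.mem_ball.2 (hrs.trans_lt ht))
        have hts : dist (p s) (p t) < ε / 8 := by
          simpa [dist_comm] using hsub ⟨t, Set.right_mem_uIcc, rfl⟩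
        constructor
        · refine hsmall _ ?_
          rw [Path.range_subpath]
          exact hsub.trans (Metric.ball_subset_ball (by linarith))
        · refine hsmall _ ?_
          rw [Path.range_subpath, Set.uIcc_comm]
          exact hsub.trans (Metric.ball_subset_ball' (by linarith))
      · rw [← Φ_congr ⟨Path.Homotopy.subpathTransSubpath p r s t⟩, Φ_trans]
        exact mul_mem hst hrs
    have hcast : ∀ {u' v' : X} (hu : u' = u) (hv : v' = v), Φ (p.cast hu hv) = Φ p := by
      rintro u' v' rfl rfl
      rfl
    rwa [Path.subpath_zero_one, hcast] at key
  refine Group.fg_iff.2 ⟨S', ?_, hfin⟩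
  rw [eq_top_iff]
  intro h _
  obtain ⟨q, hq⟩ := Path.Homotopic.Quotient.mk_surjective
    (inv (cls (τ x)) ≫ h ≫ cls (τ x) : FundamentalGroupoid.mk x ⟶ FundamentalGroupoid.mk x)
  have := hall q
  have e : Φ q = h := by
    change cls (τ x) ≫ Path.Homotopic.Quotient.mk q ≫ inv (cls (τ x)) = h
    rw [hq]
    simp
  rwa [e] at this

/-- **Sternfeld, Lemma 1.1.**  If `X` is a compact, connected, locally connected metric
space which is locally 1-connected (every neighborhood `U` of a point contains a smaller
neighborhood `V` such that every loop lying in `V` contracts in `U`), then the fundamental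
group of `X` at every basepoint is finitely generated. -/
theorem fundamentalGroup_fg_of_compact_locally_connected_locally_one_connected
    (X : Type) [MetricSpace X] [CompactSpace X] [ConnectedSpace X] [LocallyConnectedSpace X]
    (hloc : ∀ x : X, ∀ U ∈ nhds x, ∃ V ∈ nhds x, V ⊆ U ∧
      ∀ y : X, y ∈ V → ∀ γ : Path y y, Set.range γ ⊆ V →
        ∃ H : Path.Homotopy γ (Path.refl y), ∀ p : I × I, H p ∈ U) :
    ∀ x : X, Group.FG (FundamentalGroup X x) := by
  choose V hV _ hnull using fun x ↦ hloc x Set.univ Filter.univ_mem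
  obtain ⟨ε, hε, hball⟩ := lebesgue_number_lemma_of_metric (s := (Set.univ : Set X))
    isCompact_univ (c := fun x ↦ interior (V x)) (fun x ↦ isOpen_interior)
    (fun x _ ↦ Set.mem_iUnion.2 ⟨x, mem_interior_iff_mem_nhds.2 (hV x)⟩)
  obtain ⟨δ, hδ, hpath⟩ := exists_path_of_dist_lt X (show 0 < ε / 4 by positivity)
  have : PathConnectedSpace X := by
    refine ⟨inferInstance, PreconnectedSpace.induction₂' Joined (fun x ↦ ?_)
      ⟨fun _ _ _ ↦ Joined.trans⟩⟩
    filter_upwards [Metric.ball_mem_nhds x hδ] with y hy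
    obtain ⟨p, -⟩ := hpath y x hy
    exact ⟨⟨p.symm⟩, ⟨p⟩⟩
  refine FundamentalGroup.fg_of_uniform hε hδ (fun c u v p q hp hq ↦ ?_) hpath
  obtain ⟨y, hy⟩ := hball c trivial
  have hr : Set.range (p.trans q.symm) ⊆ V y := by
    rw [Path.trans_range, Path.symm_range]
    exact (Set.union_subset hp hq).trans (hy.trans interior_subset)
  obtain ⟨H, -⟩ := hnull y u (hr (Path.source_mem_range _)) _ hr
  have h : Path.Homotopic.Quotient.trans (.mk p) (.symm (.mk q)) = .refl u :=
    Path.Homotopic.Quotient.eq.2 ⟨H⟩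
  refine Path.Homotopic.Quotient.eq.1 ?_
  have h' := congrArg (fun z ↦ Path.Homotopic.Quotient.trans z (.mk q)) h
  simpa using h'
end

section
/- There is a surjective group homomorphism from the presented group T = ⟨a, b ∣ a·b·a = b·a·b⟩ onto the alternating group A₅ on five letters, sending a to the 5-cycle (1,3,5,4,2) and b to the 5-cycle (1,2,3,4,5). -/
/-- The single relator `a·b·a·(b·a·b)⁻¹` of the trefoil-knot group
`T = ⟨a, b ∣ a·b·a = b·a·b⟩`, with `a = FreeGroup.of 0` and `b = FreeGroup.of 1`. -/
def trefoilRel : Set (FreeGroup (Fin 2)) :=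
  {FreeGroup.of 0 * FreeGroup.of 1 * FreeGroup.of 0 *
    (FreeGroup.of 1 * FreeGroup.of 0 * FreeGroup.of 1)⁻¹}

/-- A subgroup of `A₅` whose order is divisible by `30` has index at most two, hence is
normal, and therefore is all of `A₅` by simplicity. -/
theorem subgroup_eq_top_of_thirty_dvd_card (H : Subgroup (alternatingGroup (Fin 5)))
    (h : 30 ∣ Nat.card H) : H = ⊤ := by
  have hcard : Nat.card (alternatingGroup (Fin 5)) = 60 := by
    rw [nat_card_alternatingGroup, Nat.card_fin]
    rfl
  have hmul := H.card_mul_index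
  rw [hcard] at hmul
  obtain ⟨k, hk⟩ := h
  have hki : k * H.index = 2 := by
    rw [hk, mul_assoc] at hmul
    omega
  have hdvd : H.index ∣ 2 := Dvd.intro_left k hki
  rcases (Nat.dvd_prime Nat.prime_two).1 hdvd with h1 | h2
  · exact Subgroup.index_eq_one.1 h1
  · have hn : H.Normal := Subgroup.normal_of_index_eq_two h2
    rcases hn.eq_bot_or_eq_top with hb | ht
    · rw [hb, Subgroup.card_bot] at hk
      omega
    · exact ht

/-- There is a surjective homomorphism from the trefoil-knot group
`T = ⟨a, b ∣ a·b·a = b·a·b⟩` onto the alternating group `A₅`, sending `a` to the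
5-cycle `(1,3,5,4,2)` and `b` to the 5-cycle `(1,2,3,4,5)` (written 0-indexed on
`Fin 5` as `(0,2,4,3,1)` and `(0,1,2,3,4)`). -/
theorem trefoil_surjects_onto_A5 :
    ∃ φ : PresentedGroup trefoilRel →* alternatingGroup (Fin 5),
      Function.Surjective φ ∧
      φ (PresentedGroup.of 0) =
        ⟨c[0, 2, 4, 3, 1], by rw [Equiv.Perm.mem_alternatingGroup]; decide⟩ ∧
      φ (PresentedGroup.of 1) =
        ⟨c[0, 1, 2, 3, 4], by rw [Equiv.Perm.mem_alternatingGroup]; decide⟩ := by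
  set x : alternatingGroup (Fin 5) :=
    ⟨c[0, 2, 4, 3, 1], by rw [Equiv.Perm.mem_alternatingGroup]; decide⟩
  set y : alternatingGroup (Fin 5) :=
    ⟨c[0, 1, 2, 3, 4], by rw [Equiv.Perm.mem_alternatingGroup]; decide⟩
  have hbraid : x * y * x = y * x * y := by decide
  have ho2 : orderOf (x * y * x) = 2 := orderOf_eq_prime (by decide) (by decide)
  have ho3 : orderOf (x * y) = 3 := orderOf_eq_prime (by decide) (by decide)
  have : Fact (Nat.Prime 5) := ⟨Nat.prime_five⟩
  have ho5 : orderOf x = 5 := orderOf_eq_prime (by decide) (by decide)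
  clear_value x y
  have hrel : ∀ r ∈ trefoilRel, FreeGroup.lift ![x, y] r = 1 := by
    rintro r rfl
    rw [map_mul, map_inv, mul_inv_eq_one]
    simpa using hbraid
  let φ := PresentedGroup.toGroup hrel
  have h0 : φ (PresentedGroup.of 0) = x := PresentedGroup.toGroup.of hrel
  have h1 : φ (PresentedGroup.of 1) = y := PresentedGroup.toGroup.of hrel
  refine ⟨φ, ?_, h0, h1⟩
  have hxm : x ∈ φ.range := ⟨_, h0⟩
  have hym : y ∈ φ.range := ⟨_, h1⟩
  have hd2 := φ.range.orderOf_dvd_natCard (mul_mem (mul_mem hxm hym) hxm)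
  have hd3 := φ.range.orderOf_dvd_natCard (mul_mem hxm hym)
  have hd5 := φ.range.orderOf_dvd_natCard hxm
  rw [ho2] at hd2
  rw [ho3] at hd3
  rw [ho5] at hd5
  exact MonoidHom.range_eq_top.1 (subgroup_eq_top_of_thirty_dvd_card _ (by omega))
end

section
/- The presented group T = ⟨a, b ∣ a·b·a = b·a·b⟩ has rank exactly 2: it is generated by the two elements a and b, and it is not generated by any single element. -/
/-- The homomorphism from the trefoil-knot group to `S₃` sending `a` and `b` to the adjacent
transpositions. -/
def trefoilToPerm : PresentedGroup trefoilRel →* Equiv.Perm (Fin 3) :=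
  PresentedGroup.toGroup (f := ![Equiv.swap 0 1, Equiv.swap 1 2]) (by
    rintro r rfl
    simp only [map_mul, map_inv, FreeGroup.lift_apply_of]
    decide)

theorem trefoilToPerm_of_zero : trefoilToPerm (PresentedGroup.of 0) = Equiv.swap 0 1 :=
  PresentedGroup.toGroup.of _

theorem trefoilToPerm_of_one : trefoilToPerm (PresentedGroup.of 1) = Equiv.swap 1 2 :=
  PresentedGroup.toGroup.of _

/-- In a group generated by a single element, any two elements commute. -/
theorem Subgroup.commute_of_closure_singleton_eq_top {G : Type*} [Group G] {g : G}
    (hg : Subgroup.closure {g} = ⊤) (x y : G) : Commute x y := by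
  obtain ⟨m, rfl⟩ := Subgroup.mem_closure_singleton.1 (hg ▸ Subgroup.mem_top x)
  obtain ⟨n, rfl⟩ := Subgroup.mem_closure_singleton.1 (hg ▸ Subgroup.mem_top y)
  exact (Commute.refl g).zpow_zpow m n

/-- **Corollary 5.2.**  The trefoil-knot group `T = ⟨a, b ∣ a·b·a = b·a·b⟩` has rank
exactly 2: it is generated by the two elements `a` and `b`, and it is not generated by
any single element. -/
theorem trefoil_rank_two :
    Subgroup.closure {PresentedGroup.of (rels := trefoilRel) 0,
      PresentedGroup.of (rels := trefoilRel) 1} = ⊤ ∧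
    ∀ g : PresentedGroup trefoilRel, Subgroup.closure {g} ≠ ⊤ := by
  constructor
  · refine (Subgroup.eq_top_iff' _).2 (PresentedGroup.generated_by _ _ fun j => ?_)
    fin_cases j <;> exact Subgroup.subset_closure (by simp)
  · intro g hg
    have h := (Subgroup.commute_of_closure_singleton_eq_top hg
      (PresentedGroup.of 0) (PresentedGroup.of 1)).map trefoilToPerm
    rw [trefoilToPerm_of_zero, trefoilToPerm_of_one] at h
    exact absurd h.eq (by decide)
end

section
/- The presented group T = ⟨a, b ∣ a·b·a = b·a·b⟩ has exactly one subgroup of index 2. -/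
/-- Two subgroups of index two that contain the same elements of a generating set are equal. -/
theorem Subgroup.eq_of_index_eq_two_of_closure_eq_top {G : Type*} [Group G] {S : Set G}
    (hS : Subgroup.closure S = ⊤) {H K : Subgroup G} (hH : H.index = 2) (hK : K.index = 2)
    (h : ∀ s ∈ S, s ∈ H ↔ s ∈ K) : H = K := by
  ext x
  have hx : x ∈ Subgroup.closure S := hS ▸ Subgroup.mem_top x
  induction hx using Subgroup.closure_induction with
  | mem s hs => exact h s hs
  | one => simp
  | mul x y _ _ hx hy =>
    rw [Subgroup.mul_mem_iff_of_index_two hH, Subgroup.mul_mem_iff_of_index_two hK]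
    exact iff_congr hx hy
  | inv x _ hx => simpa using hx

/-- The braid relation `a·b·a = b·a·b` between the generators of the trefoil-knot group. -/
theorem trefoil_braid_relation :
    (PresentedGroup.of 0 * PresentedGroup.of 1 * PresentedGroup.of 0 :
      PresentedGroup trefoilRel) =
    PresentedGroup.of 1 * PresentedGroup.of 0 * PresentedGroup.of 1 := by
  have h := PresentedGroup.one_of_mem (rels := trefoilRel) (Set.mem_singleton _)
  simp only [map_mul, map_inv, mul_inv_eq_one] at h
  exact h

/-- A subgroup of index two of the trefoil-knot group contains neither generator. -/
theorem trefoil_of_notMem_of_index_eq_two {H : Subgroup (PresentedGroup trefoilRel)}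
    (hH : H.index = 2) (i : Fin 2) : PresentedGroup.of i ∉ H := by
  have h01 : (PresentedGroup.of 0 ∈ H) ↔ (PresentedGroup.of 1 ∈ H) := by
    have h := congrArg (· ∈ H) trefoil_braid_relation
    simp only [Subgroup.mul_mem_iff_of_index_two hH, eq_iff_iff] at h
    tauto
  intro hi
  have hall : ∀ j, PresentedGroup.of j ∈ H := by
    fin_cases i <;> simp_all [Fin.forall_fin_two]
  have htop : H = ⊤ := (Subgroup.eq_top_iff' H).2 (PresentedGroup.generated_by trefoilRel H hall)
  simp [htop] at hH

/-- The homomorphism from the trefoil-knot group to `ℤˣ = {1, -1}` sending both generators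
to `-1`. -/
def trefoilSign : PresentedGroup trefoilRel →* ℤˣ :=
  PresentedGroup.toGroup (f := fun _ => -1) (by simp [trefoilRel])

theorem trefoilSign_surjective : Function.Surjective trefoilSign := by
  intro u
  rcases Int.units_eq_one_or u with rfl | rfl
  · exact ⟨1, map_one _⟩
  · exact ⟨PresentedGroup.of 0, PresentedGroup.toGroup.of _⟩

/-- (Group-theoretic content of Proposition 5.3: the cube with a trefoil-knotted hole has
a unique 2-fold cover.)  The trefoil-knot group `T = ⟨a, b ∣ a·b·a = b·a·b⟩` has exactly
one subgroup of index 2. -/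
theorem trefoil_unique_index_two_subgroup :
    ∃! H : Subgroup (PresentedGroup trefoilRel), H.index = 2 := by
  have hker : trefoilSign.ker.index = 2 := by
    rw [Subgroup.index_ker, MonoidHom.range_eq_top.2 trefoilSign_surjective, Subgroup.card_top,
      Nat.card_eq_fintype_card, Fintype.card_units_int]
  refine ⟨trefoilSign.ker, hker, fun K hK => ?_⟩
  refine Subgroup.eq_of_index_eq_two_of_closure_eq_top
    (PresentedGroup.closure_range_of trefoilRel) hK hker ?_
  rintro _ ⟨i, rfl⟩
  exact iff_of_false (trefoil_of_notMem_of_index_eq_two hK i)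
    (trefoil_of_notMem_of_index_eq_two hker i)
end

section
/- For every integer j ≥ 3 there exists a surjective group homomorphism Φ_j from the presented group G_j onto the alternating group A₅ on five letters. -/
/-- The generator indexed by level `l` (with `l = 0, …, j-1` corresponding to the paper's
`l = 1, …, j`) and letter `k` (with `k = 0, …, 8` corresponding to `a, b, c, d, e, f, g,
h, i`). -/
def bingGen (j : ℕ) (l : Fin j) (k : Fin 9) : FreeGroup (Fin j × Fin 9) :=
  FreeGroup.of (l, k)

/-- The nine Wirtinger relators `R_{l,1}, …, R_{l,9}` at level `l`. -/
def wirtingerRels (j : ℕ) (l : Fin j) : Set (FreeGroup (Fin j × Fin 9)) :=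
  let a := bingGen j l 0
  let b := bingGen j l 1
  let c := bingGen j l 2
  let d := bingGen j l 3
  let e := bingGen j l 4
  let f := bingGen j l 5
  let g := bingGen j l 6
  let h := bingGen j l 7
  let i := bingGen j l 8
  {b * (c⁻¹ * a * c)⁻¹,
   c * (a⁻¹ * b * a)⁻¹,
   d * (b⁻¹ * c * b)⁻¹,
   e * (g * d * g⁻¹)⁻¹,
   f * (h * e * h⁻¹)⁻¹,
   g * (e * f * e⁻¹)⁻¹,
   a * (h⁻¹ * g * h)⁻¹,
   h * (g⁻¹ * i * g)⁻¹,
   i * (f * h * f⁻¹)⁻¹}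

/-- The two sewing relators `S_{l',1}, S_{l',2}` relating consecutive levels `l` and
`l' = l + 1`:  `h_l = c_{l'}·a_{l'}·b_{l'}·g_{l'}⁻¹·h_{l'}⁻¹·e_{l'}⁻¹·h_{l'}` and
`f_l⁻¹·g_l = a_{l'}`. -/
def sewingRels (j : ℕ) (l l' : Fin j) : Set (FreeGroup (Fin j × Fin 9)) :=
  let f := bingGen j l 5
  let g := bingGen j l 6
  let h := bingGen j l 7
  let a' := bingGen j l' 0
  let b' := bingGen j l' 1
  let c' := bingGen j l' 2
  let e' := bingGen j l' 4
  let g' := bingGen j l' 6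
  let h' := bingGen j l' 7
  {h * (c' * a' * b' * g'⁻¹ * h'⁻¹ * e'⁻¹ * h')⁻¹,
   f⁻¹ * g * a'⁻¹}

/-- The full relator set of the presented group `G_j ≅ π₁(K_j)`: the Wirtinger relators
`R_{l,k}` for all levels `l`, the sewing relators `S_{l,1}, S_{l,2}` for consecutive
levels, and the relator `h_j = 1` at the top level. -/
def bingRels (j : ℕ) : Set (FreeGroup (Fin j × Fin 9)) :=
  (⋃ l : Fin j, wirtingerRels j l) ∪
  (⋃ l : Fin j, ⋃ (hl : (l : ℕ) + 1 < j), sewingRels j l ⟨(l : ℕ) + 1, hl⟩) ∪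
  {w | ∃ hj : 0 < j,
    w = bingGen j ⟨j - 1, Nat.sub_lt hj Nat.one_pos⟩ 7}

/-- `G_j`, the presented group of Proposition 3.1, which is `π₁(K_j)` for the knot space
`K_j` associated with Bing's contractible open 3-manifold `W³`. -/
abbrev BingGroup (j : ℕ) : Type := PresentedGroup (bingRels j)

section PresentedGroup

variable {G : Type*} [Group G]

/-- The images `t k` of the nine generators of one level satisfy the Wirtinger relations. -/
def SatisfiesWirtinger (t : Fin 9 → G) : Prop :=
  t 1 = (t 2)⁻¹ * t 0 * t 2 ∧ t 2 = (t 0)⁻¹ * t 1 * t 0 ∧ t 3 = (t 1)⁻¹ * t 2 * t 1 ∧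
  t 4 = t 6 * t 3 * (t 6)⁻¹ ∧ t 5 = t 7 * t 4 * (t 7)⁻¹ ∧ t 6 = t 4 * t 5 * (t 4)⁻¹ ∧
  t 0 = (t 7)⁻¹ * t 6 * t 7 ∧ t 7 = (t 6)⁻¹ * t 8 * t 6 ∧ t 8 = t 5 * t 7 * (t 5)⁻¹

/-- The images `t` of the generators of one level and `t'` of those of the next level satisfy
the sewing relations. -/
def SatisfiesSewing (t t' : Fin 9 → G) : Prop :=
  t 7 = t' 2 * t' 0 * t' 1 * (t' 6)⁻¹ * (t' 7)⁻¹ * (t' 4)⁻¹ * t' 7 ∧ (t 5)⁻¹ * t 6 = t' 0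

instance [DecidableEq G] (t : Fin 9 → G) : Decidable (SatisfiesWirtinger t) := by
  unfold SatisfiesWirtinger; infer_instance

instance [DecidableEq G] (t t' : Fin 9 → G) : Decidable (SatisfiesSewing t t') := by
  unfold SatisfiesSewing; infer_instance

/-- A sequence of levels, numbered from the top one downwards, whose levels satisfy the Wirtinger
relations and whose consecutive levels satisfy the sewing relations, kills all relators of `G_j`. -/
theorem lift_bingRels_eq_one {s : ℕ → Fin 9 → G} (htop : s 0 7 = 1)
    (hw : ∀ n, SatisfiesWirtinger (s n)) (hs : ∀ n, SatisfiesSewing (s (n + 1)) (s n)) (j : ℕ) :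
    ∀ r ∈ bingRels j, FreeGroup.lift (fun p : Fin j × Fin 9 => s (j - 1 - p.1) p.2) r = 1 := by
  rintro r ((hr | hr) | ⟨hj, rfl⟩)
  · obtain ⟨l, hr⟩ := Set.mem_iUnion.mp hr
    obtain ⟨h1, h2, h3, h4, h5, h6, h7, h8, h9⟩ := hw (j - 1 - l)
    simp only [wirtingerRels, Set.mem_insert_iff, Set.mem_singleton_iff] at hr
    rcases hr with rfl | rfl | rfl | rfl | rfl | rfl | rfl | rfl | rfl <;>
      simpa only [bingGen, map_mul, map_inv, FreeGroup.lift_apply_of, mul_inv_eq_one]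
  · obtain ⟨l, hr⟩ := Set.mem_iUnion.mp hr
    obtain ⟨hl, hr⟩ := Set.mem_iUnion.mp hr
    have hn : j - 1 - (l : ℕ) = j - 1 - (l + 1) + 1 := by lia
    obtain ⟨h1, h2⟩ := hs (j - 1 - (l + 1))
    simp only [sewingRels, Set.mem_insert_iff, Set.mem_singleton_iff] at hr
    rcases hr with rfl | rfl <;>
      simpa only [bingGen, map_mul, map_inv, FreeGroup.lift_apply_of, mul_inv_eq_one, hn]
  · simpa [bingGen] using htop

end PresentedGroup

section Representation

open Equiv.Perm

/-- The cyclic permutation of a list of odd length, as an element of the alternating group. -/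
def evenCycle (l : List (Fin 5)) (h : sign l.formPerm = 1) : alternatingGroup (Fin 5) :=
  ⟨l.formPerm, h⟩

/-- The level that starts the representation at the top: a cyclic one, killing `h` and `i`. -/
def topLevel : Fin 9 → alternatingGroup (Fin 5) :=
  let z := evenCycle [0, 1, 2, 3, 4] (by decide)
  ![z, z, z, z, z, z, z, 1, 1]

/-- The levels at odd distance from the top. -/
def oddLevel : Fin 9 → alternatingGroup (Fin 5) :=
  ![evenCycle [0, 2, 4, 3, 1] (by decide), evenCycle [0, 4, 1, 3, 2] (by decide),
    evenCycle [0, 1, 2, 3, 4] (by decide), evenCycle [0, 2, 4, 3, 1] (by decide),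
    evenCycle [0, 3, 4, 1, 2] (by decide), evenCycle [0, 2, 3, 1, 4] (by decide),
    evenCycle [0, 4, 2, 1, 3] (by decide), evenCycle [0, 1, 2, 3, 4] (by decide),
    evenCycle [0, 2, 4, 3, 1] (by decide)]

/-- The levels at positive even distance from the top. -/
def evenLevel : Fin 9 → alternatingGroup (Fin 5) :=
  ![evenCycle [0, 1, 2, 3, 4] (by decide), evenCycle [0, 4, 2, 1, 3] (by decide),
    evenCycle [0, 2, 4, 3, 1] (by decide), evenCycle [0, 1, 2, 3, 4] (by decide),
    evenCycle [0, 2, 1, 4, 3] (by decide), evenCycle [0, 3, 1, 2, 4] (by decide),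
    evenCycle [0, 4, 1, 3, 2] (by decide), evenCycle [0, 2, 4, 3, 1] (by decide),
    evenCycle [0, 1, 2, 3, 4] (by decide)]

/-- The images of the generators at distance `n` from the top level. -/
def levelImage : ℕ → Fin 9 → alternatingGroup (Fin 5)
  | 0 => topLevel
  | 1 => oddLevel
  | 2 => evenLevel
  | n + 3 => levelImage (n + 1)

theorem satisfiesWirtinger_levelImage : ∀ n, SatisfiesWirtinger (levelImage n)
  | 0 => by decide +kernel
  | 1 => by decide +kernel
  | 2 => by decide +kernel
  | n + 3 => satisfiesWirtinger_levelImage (n + 1)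

theorem satisfiesSewing_levelImage : ∀ n, SatisfiesSewing (levelImage (n + 1)) (levelImage n)
  | 0 => by decide +kernel
  | 1 => by decide +kernel
  | 2 => by decide +kernel
  | n + 3 => satisfiesSewing_levelImage (n + 1)

/-- A subgroup of `A₅` whose order is divisible by `30` has index at most two, so it is normal. -/
theorem Subgroup.eq_top_of_thirty_dvd_card {H : Subgroup (alternatingGroup (Fin 5))}
    (h : 30 ∣ Nat.card H) : H = ⊤ := by
  have hcard : Nat.card (alternatingGroup (Fin 5)) = 60 := by
    have := two_mul_nat_card_alternatingGroup (α := Fin 5)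
    rw [Nat.card_perm, Nat.card_fin, show Nat.factorial 5 = 120 from rfl] at this
    lia
  have hmul := H.card_mul_index
  obtain ⟨k, hk⟩ := h
  rw [hk, hcard, mul_assoc] at hmul
  have hki : k * H.index = 2 := by lia
  have hdvd : H.index ∣ 2 := Dvd.intro_left k hki
  rcases (Nat.dvd_prime Nat.prime_two).mp hdvd with h1 | h2
  · exact Subgroup.index_eq_one.mp h1
  · have := Subgroup.normal_of_index_eq_two h2
    refine (IsSimpleGroup.eq_bot_or_eq_top_of_normal H this).resolve_left ?_
    rintro rfl
    simp at hk
    lia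

theorem eq_top_of_oddLevel_mem {H : Subgroup (alternatingGroup (Fin 5))}
    (h : ∀ k, oddLevel k ∈ H) : H = ⊤ := by
  have dvd_card {p : ℕ} [Fact p.Prime] {x : alternatingGroup (Fin 5)} (hx : x ∈ H)
      (hp : x ^ p = 1) (h1 : x ≠ 1) : p ∣ Nat.card H :=
    orderOf_eq_prime hp h1 ▸ H.orderOf_dvd_natCard hx
  have := Fact.mk Nat.prime_five
  have h5 : 5 ∣ Nat.card H := dvd_card (h 0) (by decide +kernel) (by decide +kernel)
  have h3 : 3 ∣ Nat.card H := dvd_card (mul_mem (h 0) (h 1)) (by decide +kernel) (by decide +kernel)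
  have h2 : 2 ∣ Nat.card H :=
    dvd_card (mul_mem (mul_mem (h 0) (h 2)) (h 2)) (by decide +kernel) (by decide +kernel)
  exact Subgroup.eq_top_of_thirty_dvd_card (by lia)

end Representation

/-- **Section 4.**  For every `j ≥ 3` there is a surjective homomorphism
`Φ_j : G_j ↠ A₅` from the presented group `G_j ≅ π₁(K_j)` onto the alternating group on
five letters. -/
theorem bingGroup_surjects_onto_A5 :
    ∀ j : ℕ, 3 ≤ j →
      ∃ φ : BingGroup j →* alternatingGroup (Fin 5), Function.Surjective φ := by
  intro j hj
  refine ⟨PresentedGroup.toGroup (lift_bingRels_eq_one (s := levelImage) rfl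
    satisfiesWirtinger_levelImage satisfiesSewing_levelImage j), ?_⟩
  refine MonoidHom.range_eq_top.mp (eq_top_of_oddLevel_mem fun k =>
    ⟨PresentedGroup.of (⟨j - 2, by lia⟩, k), ?_⟩)
  have hn : j - 1 - (j - 2) = 1 := by lia
  simp only [PresentedGroup.toGroup.of, hn, levelImage]
end

section
/- The ranks of the presented groups G_j are unbounded: for every natural number N there exists an integer j ≥ 1 such that every generating set of G_j has cardinality greater than N. In particular, the groups G_j ≅ π₁(K_j) are not of uniformly bounded rank as j → ∞. -/
/-- A group generated by `S` has at most `#Q ^ #S` homomorphisms to `Q`. -/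
theorem mk_monoidHom_le_of_closure_eq_top.{u} {G Q : Type u} [Group G] [Group Q] {S : Set G}
    (hS : Subgroup.closure S = ⊤) :
    Cardinal.mk (G →* Q) ≤ Cardinal.mk Q ^ Cardinal.mk S := by
  rw [Cardinal.power_def]
  refine Cardinal.mk_le_of_injective (f := fun (φ : G →* Q) (s : S) => φ s) fun φ ψ h => ?_
  exact MonoidHom.eq_of_eqOn_dense hS fun s hs => congrFun h ⟨s, hs⟩

/-- The labels of the nine generators of one level satisfy the Wirtinger relations. -/
def IsWirtingerLabelling {Q : Type*} [Group Q] (L : Fin 9 → Q) : Prop :=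
  L 1 = (L 2)⁻¹ * L 0 * L 2 ∧
  L 2 = (L 0)⁻¹ * L 1 * L 0 ∧
  L 3 = (L 1)⁻¹ * L 2 * L 1 ∧
  L 4 = L 6 * L 3 * (L 6)⁻¹ ∧
  L 5 = L 7 * L 4 * (L 7)⁻¹ ∧
  L 6 = L 4 * L 5 * (L 4)⁻¹ ∧
  L 0 = (L 7)⁻¹ * L 6 * L 7 ∧
  L 7 = (L 6)⁻¹ * L 8 * L 6 ∧
  L 8 = L 5 * L 7 * (L 5)⁻¹

/-- The labels of two consecutive levels satisfy the sewing relations. -/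
def IsSewn {Q : Type*} [Group Q] (L L' : Fin 9 → Q) : Prop :=
  L 7 = L' 2 * L' 0 * L' 1 * (L' 6)⁻¹ * (L' 7)⁻¹ * (L' 4)⁻¹ * L' 7 ∧
  (L 5)⁻¹ * L 6 = L' 0

instance {Q : Type*} [Group Q] [DecidableEq Q] (L : Fin 9 → Q) :
    Decidable (IsWirtingerLabelling L) := by
  unfold IsWirtingerLabelling; infer_instance

instance {Q : Type*} [Group Q] [DecidableEq Q] (L L' : Fin 9 → Q) :
    Decidable (IsSewn L L') := by
  unfold IsSewn; infer_instance

theorem lift_eq_one_of_mem_bingRels {Q : Type*} [Group Q] {j : ℕ} (L : ℕ → Fin 9 → Q)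
    (hW : ∀ l < j, IsWirtingerLabelling (L l))
    (hS : ∀ l, l + 1 < j → IsSewn (L l) (L (l + 1)))
    (htop : L (j - 1) 7 = 1) :
    ∀ r ∈ bingRels j, FreeGroup.lift (fun p : Fin j × Fin 9 => L p.1 p.2) r = 1 := by
  rintro r ((hr | hr) | ⟨hj, rfl⟩)
  · obtain ⟨l, hl⟩ := Set.mem_iUnion.1 hr
    obtain ⟨h1, h2, h3, h4, h5, h6, h7, h8, h9⟩ := hW l l.2
    simp only [wirtingerRels, bingGen, Set.mem_insert_iff, Set.mem_singleton_iff] at hl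
    rcases hl with rfl | rfl | rfl | rfl | rfl | rfl | rfl | rfl | rfl <;>
      rw [map_mul, map_inv, mul_inv_eq_one] <;>
      simpa only [map_mul, map_inv, FreeGroup.lift_apply_of]
  · simp only [Set.mem_iUnion] at hr
    obtain ⟨l, hl, hr⟩ := hr
    obtain ⟨h1, h2⟩ := hS l hl
    simp only [sewingRels, bingGen, Set.mem_insert_iff, Set.mem_singleton_iff] at hr
    rcases hr with rfl | rfl <;>
      rw [map_mul, map_inv, mul_inv_eq_one] <;>
      simpa only [map_mul, map_inv, FreeGroup.lift_apply_of]
  · simpa only [bingGen, FreeGroup.lift_apply_of] using htop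

/-- The labelling of one level that the labels of the letters `a`, `c` and `h` force
through the Wirtinger relations. -/
def levelLabels {Q : Type*} [Group Q] (a c h : Q) : Fin 9 → Q :=
  let b := c⁻¹ * a * c
  let d := b⁻¹ * c * b
  let g := h * a * h⁻¹
  let e := g * d * g⁻¹
  let f := h * e * h⁻¹
  ![a, b, c, d, e, f, g, h, g * h * g⁻¹]

/-- The 5-cycle `(0 1 2 3 4)`. -/
def cycleX : Equiv.Perm (Fin 5) := ⟨![1, 2, 3, 4, 0], ![4, 0, 1, 2, 3], by decide, by decide⟩

/-- The 5-cycle `(0 2 4 3 1)`. -/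
def cycleY : Equiv.Perm (Fin 5) := ⟨![2, 0, 4, 1, 3], ![1, 3, 0, 4, 2], by decide, by decide⟩

/-- The 5-cycle `(0 1 4 2 3)`, a conjugate of `cycleX` by a power of `cycleY`. -/
def cycleX' : Equiv.Perm (Fin 5) := ⟨![1, 4, 3, 0, 2], ![3, 0, 4, 2, 1], by decide, by decide⟩

/-- A labelling of `2 * n + 1` levels by 5-cycles that alternates between two labellings of a
level, except at the level `2 * k + 1`, where the label of the letter `c` is changed, and at the
last level, where the label of `h` has to be trivial. -/
def fiveCycleLabels (n k l : ℕ) : Fin 9 → Equiv.Perm (Fin 5) :=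
  if l = 2 * n then levelLabels cycleX cycleX 1
  else if l % 2 = 0 then levelLabels cycleX cycleY cycleY
  else if l = 2 * k + 1 then levelLabels cycleY cycleX' cycleX
  else levelLabels cycleY cycleX cycleX

set_option maxRecDepth 10000 in
theorem isWirtingerLabelling_fiveCycleLabels (n k l : ℕ) :
    IsWirtingerLabelling (fiveCycleLabels n k l) := by
  unfold fiveCycleLabels
  split_ifs <;> decide

theorem isSewn_fiveCycleLabels (n k l : ℕ) (hl : l + 1 < 2 * n + 1) :
    IsSewn (fiveCycleLabels n k l) (fiveCycleLabels n k (l + 1)) := by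
  unfold fiveCycleLabels
  split_ifs <;> first | omega | decide

/-- The homomorphism to the symmetric group given by `fiveCycleLabels`. -/
def fiveCycleHom (n k : ℕ) : BingGroup (2 * n + 1) →* Equiv.Perm (Fin 5) :=
  PresentedGroup.toGroup (lift_eq_one_of_mem_bingRels (fiveCycleLabels n k)
    (fun l _ => isWirtingerLabelling_fiveCycleLabels n k l) (isSewn_fiveCycleLabels n k) <| by
      simp [fiveCycleLabels, levelLabels])

theorem fiveCycleHom_injective (n : ℕ) :
    Function.Injective fun k : Fin n => fiveCycleHom n k := by
  intro k k' h
  have h2 : fiveCycleLabels n k (2 * k + 1) 2 = fiveCycleLabels n k' (2 * k + 1) 2 := by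
    simpa [fiveCycleHom] using
      DFunLike.congr_fun h (PresentedGroup.of (⟨2 * k + 1, by omega⟩, 2))
  by_contra hne
  have h3 : (k : ℕ) ≠ k' := fun h => hne (Fin.ext h)
  unfold fiveCycleLabels at h2
  split_ifs at h2 <;> first | omega | exact absurd h2 (by decide)

/-- **Section 6 (core of Theorem 1.1).**  The ranks of the groups `G_j ≅ π₁(K_j)` are
unbounded: for every `N` there is some `j ≥ 1` such that every generating set of `G_j`
has cardinality greater than `N`. -/
theorem bingGroup_rank_unbounded :
    ∀ N : ℕ, ∃ j : ℕ, 1 ≤ j ∧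
      ∀ S : Set (BingGroup j), Subgroup.closure S = ⊤ →
        (N : Cardinal) < Cardinal.mk S := by
  intro N
  refine ⟨2 * (120 ^ N + 1) + 1, by omega, fun S hS => lt_of_not_ge fun hN => ?_⟩
  have h1 := Cardinal.mk_le_of_injective (fiveCycleHom_injective (120 ^ N + 1))
  have h2 := mk_monoidHom_le_of_closure_eq_top (Q := Equiv.Perm (Fin 5)) hS
  have hQ : Cardinal.mk (Equiv.Perm (Fin 5)) = (120 : ℕ) := by
    rw [Cardinal.mk_fintype, Fintype.card_perm, Fintype.card_fin]; rfl
  have h3 := (h1.trans h2).trans (Cardinal.power_le_power_left (Cardinal.mk_ne_zero _) hN)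
  rw [hQ, Cardinal.mk_fin, Cardinal.power_natCast] at h3
  have h4 : 120 ^ N + 1 ≤ 120 ^ N := by exact_mod_cast h3
  omega
end
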